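/- Assume each ξ_ij is continuously differentiable on [0,∞) and that for all i ≠ j there exists q_ij = q_ji > 0 with ξ_ij(r) = 0 if and only if r = 0 or r ≥ q_ij. Let x : [0,∞) → (ℝ^d)^n be differentiable with x'(t) = f(x(t)) for all t ≥ 0. Then there exists exactly one partition P of {1,…,n} such that the ω-limit set of the trajectory (the set of all limits of sequences x(t_m) with t_m → ∞) is nonempty and contained in F̄_P. -/

import Mathlib

open Filter Topology in
/-- Barbalat-type lemma. -/
lemma aux_barbalat (V g : ℝ → ℝ) (hV : ∀ t, 0 ≤ t → HasDerivAt V (-g t) t)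
    (hV0 : ∀ t, 0 ≤ V t) (hg : ∀ t, 0 ≤ t → 0 ≤ g t)
    (huc : ∀ ε > 0, ∃ δ > 0, ∀ s t, 0 ≤ s → s ≤ t → t ≤ s + δ → g s - ε ≤ g t)
    (ε : ℝ) (hε : 0 < ε) : ∃ T, 0 ≤ T ∧ ∀ t, T ≤ t → g t < ε := by
  have hmono : ∀ (c s t : ℝ), 0 ≤ s → s ≤ t → (∀ u, s ≤ u → u ≤ t → c ≤ g u) →
      c * (t - s) ≤ V s - V t := by
    intro c s t hs hst hc
    have := Convex.image_sub_le_mul_sub_of_deriv_le (convex_Icc s t) (f := V) (C := -c)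
      (fun u hu => (hV u (hs.trans hu.1)).continuousAt.continuousWithinAt)
      (fun u hu => by
        rw [interior_Icc] at hu
        exact (hV u (hs.trans hu.1.le)).differentiableAt.differentiableWithinAt)
      (fun u hu => by
        rw [interior_Icc] at hu
        rw [(hV u (hs.trans hu.1.le)).deriv]
        linarith [hc u hu.1.le hu.2.le])
      s (Set.left_mem_Icc.2 hst) t (Set.right_mem_Icc.2 hst) hst
    linarith
  obtain ⟨δ, hδ, h⟩ := huc (ε / 2) (by linarith)
  set S := V '' Set.Ici 0 with hS
  have hbdd : BddBelow S := ⟨0, by rintro _ ⟨t, -, rfl⟩; exact hV0 t⟩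
  have hne : S.Nonempty := ⟨V 0, 0, Set.self_mem_Ici, rfl⟩
  obtain ⟨_, ⟨T, hT, rfl⟩, hT2⟩ := exists_lt_of_csInf_lt hne
    (show sInf S < sInf S + ε / 2 * δ by have := mul_pos hε hδ; linarith)
  refine ⟨T, hT, fun t ht => ?_⟩
  by_contra hcon
  push Not at hcon
  have hT' : (0:ℝ) ≤ T := hT
  have h1 := hmono (ε / 2) t (t + δ) (by linarith) (by linarith) (fun u hu1 hu2 => by
    have := h t u (by linarith) hu1 hu2
    linarith)
  have h2 := hmono 0 T t hT' ht (fun u hu1 _ => hg u (by linarith))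
  have h3 : sInf S ≤ V (t + δ) := csInf_le hbdd ⟨t + δ, by simp; linarith, rfl⟩
  have : ε / 2 * (t + δ - t) = ε / 2 * δ := by ring
  linarith

/-- Symmetrization identity. -/
lemma aux_symm {n d : ℕ} (c : Fin n → Fin n → ℝ) (hc : ∀ i j, c i j = c j i)
    (y : Fin n → EuclideanSpace ℝ (Fin d)) :
    ∑ i, ∑ j, 2 * (c i j * inner ℝ (y i) (y j - y i)) = - ∑ i, ∑ j, c i j * ‖y j - y i‖ ^ 2 := by
  have h1 : ∑ i, ∑ j, c i j * inner ℝ (y i) (y j - y i)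
      = ∑ i, ∑ j, c i j * inner ℝ (y j) (y i - y j) := by
    rw [Finset.sum_comm]
    refine Finset.sum_congr rfl fun i _ => Finset.sum_congr rfl fun j _ => ?_
    rw [hc]
  have h2 : ∑ i, ∑ j, 2 * (c i j * inner ℝ (y i) (y j - y i))
      = ∑ i, ∑ j, c i j * inner ℝ (y i) (y j - y i)
        + ∑ i, ∑ j, c i j * inner ℝ (y j) (y i - y j) := by
    rw [← h1]; simp only [← Finset.mul_sum]; ring
  rw [h2, ← Finset.sum_add_distrib, ← Finset.sum_neg_distrib]
  refine Finset.sum_congr rfl fun i _ => ?_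
  rw [← Finset.sum_add_distrib, ← Finset.sum_neg_distrib]
  refine Finset.sum_congr rfl fun j _ => ?_
  rw [← real_inner_self_eq_norm_sq]
  simp only [inner_sub_left, inner_sub_right, real_inner_comm (y i) (y j)]
  ring

/-- For `C¹` interaction functions vanishing exactly at `0` and beyond
the thresholds, the ω-limit set of every global solution is nonempty and contained in
`F̄_P` for exactly one partition `P` of the agents (encoded as a setoid on `Fin n`). -/
theorem omega_limit_in_unique_Fbar_partition {n d : ℕ}
    (w : Fin n → ℝ) (hw : ∀ i, 0 < w i)
    (ξ : Fin n → Fin n → ℝ → ℝ)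
    (hξnn : ∀ i j r, 0 ≤ r → 0 ≤ ξ i j r)
    (hξsym : ∀ i j, i ≠ j → ξ i j = ξ j i)
    (hξC1 : ∀ i j, i ≠ j → ContDiffOn ℝ 1 (ξ i j) (Set.Ici 0))
    (q : Fin n → Fin n → ℝ)
    (hqsym : ∀ i j, i ≠ j → q i j = q j i)
    (hqpos : ∀ i j, i ≠ j → 0 < q i j)
    (hξzero : ∀ i j, i ≠ j → ∀ r, 0 ≤ r → (ξ i j r = 0 ↔ r = 0 ∨ q i j ≤ r))
    (f : (Fin n → EuclideanSpace ℝ (Fin d)) → (Fin n → EuclideanSpace ℝ (Fin d)))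
    (hf : ∀ y i, f y i = ∑ j ∈ Finset.univ.filter (fun j => j ≠ i),
        ξ i j (‖y j - y i‖) • (w j • (y j - y i)))
    (x : ℝ → Fin n → EuclideanSpace ℝ (Fin d))
    (hx : ∀ t, 0 ≤ t → HasDerivAt x (f (x t)) t) :
    ∃! P : Setoid (Fin n),
      ({y : Fin n → EuclideanSpace ℝ (Fin d) | ∃ τ : ℕ → ℝ,
          Filter.Tendsto τ Filter.atTop Filter.atTop ∧
          Filter.Tendsto (fun m => x (τ m)) Filter.atTop (nhds y)}).Nonempty ∧
      {y : Fin n → EuclideanSpace ℝ (Fin d) | ∃ τ : ℕ → ℝ,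
          Filter.Tendsto τ Filter.atTop Filter.atTop ∧
          Filter.Tendsto (fun m => x (τ m)) Filter.atTop (nhds y)}
        ⊆ {y : Fin n → EuclideanSpace ℝ (Fin d) | ∀ i j, i ≠ j →
            ((y i = y j ↔ P.r i j) ∧ (q i j ≤ ‖y i - y j‖ ↔ ¬ P.r i j))} := by
  classical
  -- the dissipation
  set K : (Fin n → EuclideanSpace ℝ (Fin d)) → Fin n → Fin n → ℝ :=
    fun y i j => if i = j then 0 else ξ i j ‖y j - y i‖ with hK
  have hKnn : ∀ y i j, 0 ≤ K y i j := by
    intro y i j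
    simp only [hK]
    split_ifs
    · exact le_rfl
    · exact hξnn _ _ _ (norm_nonneg _)
  have hKsym : ∀ y i j, K y i j = K y j i := by
    intro y i j
    by_cases h : i = j
    · subst h; rfl
    · simp only [hK, if_neg h, if_neg (Ne.symm h)]
      rw [hξsym i j h, norm_sub_rev]
  have hKcont : ∀ i j, Continuous fun y => K y i j := by
    intro i j
    by_cases h : i = j
    · simp only [hK, if_pos h]; exact continuous_const
    · simp only [hK, if_neg h]
      exact (hξC1 i j h).continuousOn.comp_continuous (by fun_prop) (fun y => norm_nonneg _)
  have hfK : ∀ y i, f y i = ∑ j, K y i j • (w j • (y j - y i)) := by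
    intro y i
    rw [hf, Finset.sum_filter]
    refine Finset.sum_congr rfl fun j _ => ?_
    by_cases h : j = i
    · subst h; simp
    · simp [hK, h, Ne.symm h]
  have hfcont : Continuous f := by
    refine continuous_pi fun i => ?_
    simp only [hfK]
    refine continuous_finsetSum _ fun j _ => (hKcont i j).smul ?_
    fun_prop
  set D : (Fin n → EuclideanSpace ℝ (Fin d)) → ℝ :=
    fun y => ∑ i, ∑ j, (w i * w j * K y i j) * ‖y j - y i‖ ^ 2 with hD
  have hDcont : Continuous D := by
    refine continuous_finsetSum _ fun i _ => continuous_finsetSum _ fun j _ => ?_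
    exact (continuous_const.mul (hKcont i j)).mul (by fun_prop)
  have hterm : ∀ y i j, 0 ≤ (w i * w j * K y i j) * ‖y j - y i‖ ^ 2 := fun y i j =>
    mul_nonneg (mul_nonneg (mul_nonneg (hw i).le (hw j).le) (hKnn y i j)) (sq_nonneg _)
  have hDnn : ∀ y, 0 ≤ D y := fun y =>
    Finset.sum_nonneg fun i _ => Finset.sum_nonneg fun j _ => hterm y i j
  have hDterm : ∀ y i j, (w i * w j * K y i j) * ‖y j - y i‖ ^ 2 ≤ D y := by
    intro y i j
    refine (Finset.single_le_sum (f := fun j => (w i * w j * K y i j) * ‖y j - y i‖ ^ 2)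
      (fun j _ => hterm y i j) (Finset.mem_univ j)).trans ?_
    exact Finset.single_le_sum
      (f := fun i => ∑ j, (w i * w j * K y i j) * ‖y j - y i‖ ^ 2)
      (fun i _ => Finset.sum_nonneg fun j _ => hterm y i j) (Finset.mem_univ i)
  -- Lyapunov function
  set V : ℝ → ℝ := fun t => ∑ i, w i * ‖x t i‖ ^ 2 with hVdef
  have hVnn : ∀ t, 0 ≤ V t := fun t =>
    Finset.sum_nonneg fun i _ => mul_nonneg (hw i).le (sq_nonneg _)
  have hV : ∀ t, 0 ≤ t → HasDerivAt V (-D (x t)) t := by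
    intro t ht
    have h1 : HasDerivAt V (∑ i, w i * (2 * inner ℝ (x t i) (f (x t) i))) t := by
      refine HasDerivAt.fun_sum fun i _ => ?_
      exact ((hasDerivAt_pi.1 (hx t ht) i).norm_sq).const_mul (w i)
    convert h1 using 1
    simp only [hD]
    rw [← aux_symm (fun i j => w i * w j * K (x t) i j)
      (fun i j => by rw [hKsym (x t) i j]; ring) (x t)]
    refine Finset.sum_congr rfl fun i _ => ?_
    rw [hfK, inner_sum, Finset.mul_sum, Finset.mul_sum]
    refine Finset.sum_congr rfl fun j _ => ?_
    rw [inner_smul_right, inner_smul_right]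
    ring
  have hVanti : ∀ t, 0 ≤ t → V t ≤ V 0 := by
    have : AntitoneOn V (Set.Ici 0) := by
      refine antitoneOn_of_deriv_nonpos (convex_Ici 0)
        (fun u hu => (hV u hu).continuousAt.continuousWithinAt)
        (fun u hu => (hV u (interior_subset hu)).differentiableAt.differentiableWithinAt)
        (fun u hu => ?_)
      rw [(hV u (interior_subset hu)).deriv]
      linarith [hDnn (x u)]
    exact fun t ht => this Set.self_mem_Ici ht ht
  -- boundedness
  set R : ℝ := 1 + ∑ i, V 0 / w i with hR
  have hRnn' : ∀ i, 0 ≤ V 0 / w i := fun i => div_nonneg (hVnn 0) (hw i).le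
  have hRnn : 0 ≤ R := by
    have := Finset.sum_nonneg fun i (_ : i ∈ Finset.univ) => hRnn' i
    linarith
  have hbd : ∀ t, 0 ≤ t → x t ∈ Metric.closedBall (0 : Fin n → EuclideanSpace ℝ (Fin d)) R := by
    intro t ht
    rw [mem_closedBall_zero_iff, pi_norm_le_iff_of_nonneg hRnn]
    intro i
    have h1 : w i * ‖x t i‖ ^ 2 ≤ V 0 :=
      (Finset.single_le_sum (f := fun i => w i * ‖x t i‖ ^ 2)
        (fun i _ => mul_nonneg (hw i).le (sq_nonneg _)) (Finset.mem_univ i)).trans (hVanti t ht)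
    have h2 : ‖x t i‖ ^ 2 ≤ V 0 / w i := by
      rw [le_div_iff₀ (hw i)]; linarith
    have h3 : V 0 / w i ≤ ∑ i, V 0 / w i :=
      Finset.single_le_sum (f := fun i => V 0 / w i) (fun i _ => hRnn' i) (Finset.mem_univ i)
    nlinarith [sq_nonneg (‖x t i‖ - 1), norm_nonneg (x t i)]
  have hcomp : IsCompact (Metric.closedBall (0 : Fin n → EuclideanSpace ℝ (Fin d)) R) :=
    isCompact_closedBall _ _
  obtain ⟨M, hM⟩ := hcomp.exists_bound_of_continuousOn hfcont.continuousOn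
  have hMnn : 0 ≤ M := (norm_nonneg _).trans (hM _ (hbd 0 le_rfl))
  have hlip : ∀ s t, 0 ≤ s → s ≤ t → ‖x t - x s‖ ≤ M * (t - s) := by
    intro s t hs hst
    have := Convex.norm_image_sub_le_of_norm_hasDerivWithin_le (f := x) (s := Set.Icc s t) (C := M)
      (fun u hu => (hx u (hs.trans hu.1)).hasDerivWithinAt)
      (fun u hu => hM _ (hbd u (hs.trans hu.1))) (convex_Icc s t)
      (Set.left_mem_Icc.2 hst) (Set.right_mem_Icc.2 hst)
    rwa [Real.norm_of_nonneg (by linarith)] at this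
  have hDuc := hcomp.uniformContinuousOn_of_continuous hDcont.continuousOn
  rw [Metric.uniformContinuousOn_iff] at hDuc
  have hbar := aux_barbalat V (fun t => D (x t)) hV hVnn (fun t _ => hDnn _) (by
    intro ε hε
    obtain ⟨η, hη, h⟩ := hDuc ε hε
    refine ⟨η / (M + 1), by positivity, fun s t hs hst hts => ?_⟩
    have h1 : ‖x t - x s‖ < η := by
      refine (hlip s t hs hst).trans_lt ?_
      have h2 : t - s ≤ η / (M + 1) := by linarith
      rw [le_div_iff₀ (by linarith)] at h2
      rcases hst.eq_or_lt with rfl | h3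
      · simpa using hη
      · nlinarith
    have h2 := h (x t) (hbd t (hs.trans hst)) (x s) (hbd s hs) (by rwa [dist_eq_norm])
    rw [Real.dist_eq, abs_lt] at h2
    show D (x s) - ε ≤ D (x t)
    linarith [h2.1])
  -- name the omega limit set
  set Ω : Set (Fin n → EuclideanSpace ℝ (Fin d)) := {y | ∃ τ : ℕ → ℝ,
          Filter.Tendsto τ Filter.atTop Filter.atTop ∧
          Filter.Tendsto (fun m => x (τ m)) Filter.atTop (nhds y)} with hΩ
  have hΩne : Ω.Nonempty := by
    obtain ⟨y, -, φ, hφ, hy⟩ := hcomp.tendsto_subseq (x := fun m : ℕ => x m)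
      (fun m => hbd _ (Nat.cast_nonneg m))
    exact ⟨y, fun m => (φ m : ℝ), tendsto_natCast_atTop_atTop.comp hφ.tendsto_atTop, hy⟩
  have hΩD : ∀ y ∈ Ω, D y = 0 := by
    rintro y ⟨τ, hτ, hy⟩
    refine le_antisymm (le_of_forall_pos_le_add fun ε hε => ?_) (hDnn y)
    obtain ⟨T, -, hT⟩ := hbar ε hε
    refine le_of_tendsto ((hDcont.tendsto y).comp hy) ?_
    filter_upwards [hτ.eventually_ge_atTop T] with m hm
    have := hT _ hm
    simp only [Function.comp]
    linarith
  have hdich : ∀ y ∈ Ω, ∀ i j, i ≠ j → y i = y j ∨ q i j ≤ ‖y i - y j‖ := by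
    intro y hy i j hij
    have h1 : (w i * w j * K y i j) * ‖y j - y i‖ ^ 2 = 0 :=
      le_antisymm ((hDterm y i j).trans (hΩD y hy).le) (hterm y i j)
    have hwi := (hw i).ne'
    have hwj := (hw j).ne'
    have h2 : K y i j = 0 ∨ ‖y j - y i‖ = 0 := by
      simpa [hwi, hwj] using h1
    have h3 : ‖y j - y i‖ = 0 ∨ q i j ≤ ‖y j - y i‖ := by
      rcases h2 with h2 | h2
      · simp only [hK, if_neg hij] at h2
        exact (hξzero i j hij _ (norm_nonneg _)).1 h2
      · exact Or.inl h2
    rcases h3 with h3 | h3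
    · left; exact (sub_eq_zero.1 (norm_eq_zero.1 h3)).symm
    · right; rwa [norm_sub_rev]
  -- each pair is decided uniformly on the omega limit set
  have hunif : ∀ i j, i ≠ j → (∀ y ∈ Ω, y i = y j) ∨ (∀ y ∈ Ω, y i ≠ y j) := by
    intro i j hij
    have hq := hqpos i j hij
    have hξp : 0 < ξ i j (q i j / 2) := by
      refine lt_of_le_of_ne (hξnn i j _ (by linarith)) fun h => ?_
      rcases (hξzero i j hij _ (by linarith)).1 h.symm with h | h <;> linarith
    obtain ⟨T, hT0, hT⟩ := hbar ((w i * w j * ξ i j (q i j / 2)) * (q i j / 2) ^ 2)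
      (mul_pos (mul_pos (mul_pos (hw i) (hw j)) hξp) (by positivity))
    have hne : ∀ t, T ≤ t → ‖x t j - x t i‖ ≠ q i j / 2 := by
      intro t ht heq
      have h1 := hDterm (x t) i j
      simp only [hK, if_neg hij, heq] at h1
      exact absurd (hT t ht) (not_lt.2 h1)
    have hcts : ContinuousOn (fun t => ‖x t j - x t i‖) (Set.Ici T) := by
      intro t ht
      have hxc := (hx t (hT0.trans ht)).continuousAt
      have : ContinuousAt (fun t => ‖x t j - x t i‖) t :=
        (((continuous_apply j).continuousAt.comp hxc).sub
          ((continuous_apply i).continuousAt.comp hxc)).norm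
      exact this.continuousWithinAt
    have hlim : ∀ y : Fin n → EuclideanSpace ℝ (Fin d), ∀ τ : ℕ → ℝ,
        Filter.Tendsto (fun m => x (τ m)) Filter.atTop (nhds y) →
        Filter.Tendsto (fun m => ‖x (τ m) j - x (τ m) i‖) Filter.atTop (nhds ‖y j - y i‖) := by
      intro y τ hy
      have hc : Continuous fun y : Fin n → EuclideanSpace ℝ (Fin d) => ‖y j - y i‖ := by fun_prop
      exact (hc.tendsto y).comp hy
    rcases lt_or_gt_of_ne (hne T le_rfl) with h0 | h0
    · left
      have hall : ∀ t, T ≤ t → ‖x t j - x t i‖ < q i j / 2 := by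
        intro t ht
        by_contra hcon
        push Not at hcon
        obtain ⟨u, hu, hu2⟩ := isPreconnected_Ici.intermediate_value (Set.self_mem_Ici (a := T))
          (show t ∈ Set.Ici T from ht) hcts ⟨h0.le, hcon⟩
        exact hne u hu hu2
      intro y hy
      rcases hdich y hy i j hij with h | h
      · exact h
      · exfalso
        obtain ⟨τ, hτ, hyτ⟩ := hy
        have := le_of_tendsto (hlim y τ hyτ)
          ((hτ.eventually_ge_atTop T).mono fun m hm => (hall _ hm).le)
        rw [norm_sub_rev] at this
        linarith
    · right
      have hall : ∀ t, T ≤ t → q i j / 2 < ‖x t j - x t i‖ := by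
        intro t ht
        by_contra hcon
        push Not at hcon
        obtain ⟨u, hu, hu2⟩ := isPreconnected_Ici.intermediate_value
          (show t ∈ Set.Ici T from ht) (Set.self_mem_Ici (a := T)) hcts ⟨hcon, h0.le⟩
        exact hne u hu hu2
      rintro y ⟨τ, hτ, hyτ⟩ heq
      have := ge_of_tendsto (hlim y τ hyτ)
        ((hτ.eventually_ge_atTop T).mono fun m hm => (hall _ hm).le)
      rw [heq, sub_self, norm_zero] at this
      linarith
  obtain ⟨y₀, hy₀⟩ := hΩne
  refine ⟨Setoid.ker y₀, ⟨⟨y₀, hy₀⟩, ?_⟩, ?_⟩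
  · intro y hy i j hij
    have hq := hqpos i j hij
    have hker : (Setoid.ker y₀).r i j ↔ y₀ i = y₀ j := Iff.rfl
    have h1 : y i = y j ↔ y₀ i = y₀ j := by
      rcases hunif i j hij with h | h
      · exact iff_of_true (h y hy) (h y₀ hy₀)
      · exact iff_of_false (h y hy) (h y₀ hy₀)
    refine ⟨h1.trans hker.symm, ?_⟩
    rw [hker, ← h1]
    constructor
    · intro h2 h3
      rw [h3, sub_self, norm_zero] at h2
      linarith
    · intro h2
      exact (hdich y hy i j hij).resolve_left h2
  · rintro P ⟨-, hP⟩
    refine Setoid.ext fun i j => ?_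
    by_cases hij : i = j
    · subst hij
      exact iff_of_true (P.refl i) ((Setoid.ker y₀).refl i)
    · exact ((hP hy₀ i j hij).1).symm
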